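/- Fix positive integers n, K, d, a real β > 0, feature vectors u : Fin n → (Fin d → ℝ), and one-hot labels y : Fin n → Fin K → ℝ where for each i there is exactly one class c i with y i (c i) = 1 and y i k = 0 otherwise. Let p*_{ik} = (∑_{i'} y_{i'k} · 1[u_{i'} = u_i]) / (#{i' : u_{i'} = u_i}) and let g* be any predictor with g*(u_i)_k = p*_{ik} for all i, k. If g is a predictor with g(u_i)_{c i} > 0 for all i and L(g) = L(g*), then g(u_i)_k = p*_{ik} for every i and k. -/

import Mathlib

open scoped Classical

/-- Conditional-frequency values: `pstar u y i k` is the fraction of samples `i'`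
with the same feature vector as `i` that have label `k`. -/
noncomputable def pstar {n d K : ℕ} (u : Fin n → Fin d → ℝ)
    (y : Fin n → Fin K → ℝ) (i : Fin n) (k : Fin K) : ℝ :=
  (∑ i', y i' k * (if u i' = u i then (1 : ℝ) else 0)) /
    ((Finset.univ.filter fun i' => u i' = u i).card : ℝ)

/-- The calibrated loss: cross-entropy plus `β` times the bin-free class-wise
calibration term. -/
noncomputable def loss {n d K : ℕ} (β : ℝ) (u : Fin n → Fin d → ℝ)
    (y : Fin n → Fin K → ℝ) (g : (Fin d → ℝ) → Fin K → ℝ) : ℝ :=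
  -((1 / (n : ℝ)) * ∑ i, ∑ k, y i k * Real.log (g (u i) k)) +
    β * ((1 / (K : ℝ)) *
      ∑ k, |(1 / (n : ℝ)) * ∑ i, g (u i) k - (1 / (n : ℝ)) * ∑ i, y i k|)

/-- Replacing the labels by their conditional frequencies does not change the sum against
a function of the features. -/
theorem sum_pstar_mul {n d K : ℕ} (u : Fin n → Fin d → ℝ) (y : Fin n → Fin K → ℝ)
    (k : Fin K) (h : (Fin d → ℝ) → ℝ) :
    ∑ i, pstar u y i k * h (u i) = ∑ i, y i k * h (u i) := by
  unfold pstar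
  simp_rw [Finset.sum_div, Finset.sum_mul]
  rw [Finset.sum_comm]
  refine Finset.sum_congr rfl fun j _ => ?_
  have hcard : ((Finset.univ.filter fun i => u i = u j).card : ℝ) ≠ 0 :=
    Nat.cast_ne_zero.mpr (Finset.card_ne_zero_of_mem
      (Finset.mem_filter.mpr ⟨Finset.mem_univ j, rfl⟩))
  calc
    _ = ∑ i, if u i = u j then
          y j k * h (u j) / ((Finset.univ.filter fun i' => u i' = u j).card : ℝ) else 0 := by
        refine Finset.sum_congr rfl fun i _ => ?_
        by_cases hij : u i = u j
        · simp only [hij, if_true]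
          ring
        · simp [hij, Ne.symm hij]
    _ = y j k * h (u j) := by
        rw [← Finset.sum_filter, Finset.sum_const, nsmul_eq_mul]
        field_simp

/-- A class with nonzero conditional frequency occurs as a label at the same feature vector. -/
theorem exists_of_pstar_ne_zero {n d K : ℕ} {u : Fin n → Fin d → ℝ} {y : Fin n → Fin K → ℝ}
    {i : Fin n} {k : Fin K} (h : pstar u y i k ≠ 0) : ∃ j, u j = u i ∧ y j k ≠ 0 := by
  contrapose! h
  unfold pstar
  rw [Finset.sum_eq_zero, zero_div]
  intro j _
  by_cases hj : u j = u i
  · simp [h j hj]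
  · simp [hj]

/-- Pointwise Gibbs inequality. -/
theorem sub_le_mul_log_sub_log {p q : ℝ} (hp : 0 ≤ p) (hq : 0 ≤ q) (hpq : p ≠ 0 → 0 < q) :
    p - q ≤ p * (Real.log p - Real.log q) := by
  rcases hp.eq_or_lt with rfl | hp
  · simpa using hq
  · have hq := hpq hp.ne'
    have h := mul_le_mul_of_nonneg_left (Real.log_le_sub_one_of_pos (div_pos hq hp)) hp.le
    rw [Real.log_div hq.ne' hp.ne', mul_sub p (q / p), mul_div_cancel₀ q hp.ne'] at h
    linarith

/-- Equality case of the pointwise Gibbs inequality. -/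
theorem eq_of_sub_eq_mul_log_sub_log {p q : ℝ} (hp : 0 ≤ p) (hpq : p ≠ 0 → 0 < q)
    (h : p - q = p * (Real.log p - Real.log q)) : q = p := by
  rcases hp.eq_or_lt with rfl | hp
  · linarith
  · have hq := hpq hp.ne'
    by_contra hne
    have hlt := mul_lt_mul_of_pos_left (Real.log_lt_sub_one_of_pos (div_pos hq hp)
      fun h1 => hne ((div_eq_one_iff_eq hp.ne').mp h1)) hp
    rw [Real.log_div hq.ne' hp.ne', mul_sub p (q / p), mul_div_cancel₀ q hp.ne'] at hlt
    linarith

/-- If a predictor `g` (positive on the true labels) attains the same loss as a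
predictor `g*` outputting the conditional frequencies `p*` on the training features,
then `g` also outputs `p*` on the training features. -/
theorem loss_eq_implies_pstar (n K d : ℕ) (hn : 0 < n) (hK : 0 < K) (hd : 0 < d)
    (β : ℝ) (hβ : 0 < β)
    (u : Fin n → Fin d → ℝ) (y : Fin n → Fin K → ℝ) (c : Fin n → Fin K)
    (hy : ∀ i, y i (c i) = 1 ∧ ∀ k, k ≠ c i → y i k = 0)
    (gstar : (Fin d → ℝ) → Fin K → ℝ)
    (hgstar0 : ∀ x k, 0 ≤ gstar x k) (hgstar1 : ∀ x, ∑ k, gstar x k = 1)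
    (hgstar : ∀ i k, gstar (u i) k = pstar u y i k)
    (g : (Fin d → ℝ) → Fin K → ℝ)
    (hg0 : ∀ x k, 0 ≤ g x k) (hg1 : ∀ x, ∑ k, g x k = 1)
    (hgpos : ∀ i, 0 < g (u i) (c i))
    (heq : loss β u y g = loss β u y gstar) :
    ∀ i k, g (u i) k = pstar u y i k := by
  have hn' : (0 : ℝ) < 1 / n := by positivity
  have havg (k : Fin K) (h : (Fin d → ℝ) → ℝ) :
      ∑ i, gstar (u i) k * h (u i) = ∑ i, y i k * h (u i) := by
    simp_rw [hgstar]
    exact sum_pstar_mul u y k h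
  have hcal (k : Fin K) : ∑ i, gstar (u i) k = ∑ i, y i k := by
    simpa using havg k fun _ => 1
  have hpos (i : Fin n) (k : Fin K) (h : gstar (u i) k ≠ 0) : 0 < g (u i) k := by
    rw [hgstar] at h
    obtain ⟨j, hj, hjk⟩ := exists_of_pstar_ne_zero h
    have hk : k = c j := by
      by_contra hne
      exact hjk ((hy j).2 k hne)
    rw [← hj, hk]
    exact hgpos j
  have hce : ∑ i, ∑ k, y i k * Real.log (gstar (u i) k) ≤
      ∑ i, ∑ k, y i k * Real.log (g (u i) k) := by
    simp only [loss, hcal, sub_self, abs_zero, Finset.sum_const_zero, mul_zero, add_zero] at heq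
    have hcal_nonneg : 0 ≤ β * ((1 / (K : ℝ)) *
        ∑ k, |(1 / (n : ℝ)) * ∑ i, g (u i) k - (1 / (n : ℝ)) * ∑ i, y i k|) := by
      positivity
    exact le_of_mul_le_mul_left (by linarith) hn'
  have hswap (f : (Fin d → ℝ) → Fin K → ℝ) :
      ∑ i, ∑ k, y i k * Real.log (f (u i) k) =
        ∑ i, ∑ k, gstar (u i) k * Real.log (f (u i) k) := by
    rw [Finset.sum_comm, Finset.sum_comm (f := fun i k => gstar (u i) k * _)]
    exact Finset.sum_congr rfl fun k _ => (havg k fun x => Real.log (f x k)).symm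
  rw [hswap, hswap] at hce
  have hterm (i : Fin n) (k : Fin K) : gstar (u i) k - g (u i) k ≤
      gstar (u i) k * (Real.log (gstar (u i) k) - Real.log (g (u i) k)) :=
    sub_le_mul_log_sub_log (hgstar0 _ _) (hg0 _ _) (hpos i k)
  have hsum : ∑ i, ∑ k, (gstar (u i) k - g (u i) k) =
      ∑ i, ∑ k, gstar (u i) k * (Real.log (gstar (u i) k) - Real.log (g (u i) k)) := by
    refine le_antisymm
      (Finset.sum_le_sum fun i _ => Finset.sum_le_sum fun k _ => hterm i k) ?_
    simp only [mul_sub, Finset.sum_sub_distrib, hg1, hgstar1, sub_self,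
      Finset.sum_const_zero]
    linarith
  intro i k
  have hrow := (Finset.sum_eq_sum_iff_of_le
    fun i _ => Finset.sum_le_sum fun k _ => hterm i k).mp hsum i (Finset.mem_univ i)
  have hik := (Finset.sum_eq_sum_iff_of_le fun k _ => hterm i k).mp hrow k (Finset.mem_univ k)
  rw [← hgstar]
  exact eq_of_sub_eq_mul_log_sub_log (hgstar0 _ _) (hpos i k) hik
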